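/- arXiv:2308.08450 — 2 statements merged into one kernel-verified Lean document; each statement's English description precedes it below -/
import Mathlib

section
/- For every index i ∈ {1,2,3}, the conformable Poisson bracket of the conformable Kepler Hamiltonian with the i-th component of the conformable Laplace–Runge–Lenz vector vanishes: {H_α, Aᵅᵢ}_α = 0 at every point (q,p) ∈ ℝ³ × ℝ³ with qʲ ≠ 0 and pⱼ ≠ 0 for all j. In particular each Aᵅᵢ is a constant of motion of H_α. -/
noncomputable section

/-- The conformable power helper `|x|^(α-1) * x`. -/
def confPow (α x : ℝ) : ℝ := |x| ^ (α - 1) * x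

/-- Partial derivative of `f : (q,p) ↦ ℝ` with respect to the coordinate `qⁱ`. -/
def pdq (f : (Fin 3 → ℝ) → (Fin 3 → ℝ) → ℝ) (i : Fin 3) (q p : Fin 3 → ℝ) : ℝ :=
  deriv (fun t => f (Function.update q i t) p) (q i)

/-- Partial derivative of `f : (q,p) ↦ ℝ` with respect to the coordinate `pᵢ`. -/
def pdp (f : (Fin 3 → ℝ) → (Fin 3 → ℝ) → ℝ) (i : Fin 3) (q p : Fin 3 → ℝ) : ℝ :=
  deriv (fun t => f q (Function.update p i t)) (p i)

/-- The conformable Poisson bracket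
`{f,g}_α = Σᵢ α⁻² |pᵢ|^{1-α} |qⁱ|^{1-α} (∂f/∂pᵢ ∂g/∂qⁱ - ∂f/∂qⁱ ∂g/∂pᵢ)`. -/
def confPB (α : ℝ) (f g : (Fin 3 → ℝ) → (Fin 3 → ℝ) → ℝ) (q p : Fin 3 → ℝ) : ℝ :=
  ∑ i : Fin 3, (α ^ 2)⁻¹ * |p i| ^ (1 - α) * |q i| ^ (1 - α) *
    (pdp f i q p * pdq g i q p - pdq f i q p * pdp g i q p)

/-- The conformable radius `r_α = √(Σᵢ (α|qⁱ|^{α-1}qⁱ)²)`. -/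
def rConf (α : ℝ) (q : Fin 3 → ℝ) : ℝ :=
  Real.sqrt (∑ i : Fin 3, (α * confPow α (q i)) ^ 2)

/-- The conformable Kepler Hamiltonian
`H_α = Σᵢ (α|pᵢ|^{α-1}pᵢ)²/(2m) - k/r_α`. -/
def Hconf (α m k : ℝ) (q p : Fin 3 → ℝ) : ℝ :=
  (∑ i : Fin 3, (α * confPow α (p i)) ^ 2 / (2 * m)) - k / rConf α q

/-- The conformable angular momentum components (cyclic in the indices). -/
def Lconf (α : ℝ) (i : Fin 3) (q p : Fin 3 → ℝ) : ℝ :=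
  α ^ 2 * (confPow α (q (i + 1)) * confPow α (p (i + 2)) -
           confPow α (q (i + 2)) * confPow α (p (i + 1)))

/-- The conformable Laplace–Runge–Lenz vector components (cyclic in the indices). -/
def Aconf (α m k : ℝ) (i : Fin 3) (q p : Fin 3 → ℝ) : ℝ :=
  α * (confPow α (p (i + 1)) * Lconf α (i + 2) q p -
       confPow α (p (i + 2)) * Lconf α (i + 1) q p) -
  α * m * k / rConf α q * confPow α (q i)

/-- The conformable power has derivative `α|x|^(α-1)` away from the origin. -/
theorem hasDerivAt_confPow (α : ℝ) {x : ℝ} (hx : x ≠ 0) :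
    HasDerivAt (confPow α) (α * |x| ^ (α - 1)) x := by
  have h := ((hasDerivAt_abs hx).rpow_const (p := α - 1)
    (Or.inl (abs_ne_zero.mpr hx))).mul (hasDerivAt_id x)
  refine h.congr_deriv ?_
  have hs : (SignType.sign x : ℝ) * x = |x| := by
    rw [mul_comm]; exact self_mul_sign x
  have hr : |x| ^ (α - 1 - 1) * |x| = |x| ^ (α - 1) := by
    rw [← Real.rpow_add_one (abs_ne_zero.mpr hx), sub_add_cancel]
  simp only [id]
  linear_combination ((α - 1) * |x| ^ (α - 1 - 1)) * hs + (α - 1) * hr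

theorem hasDerivAt_confPow_update (α : ℝ) {x : Fin 3 → ℝ} {j : Fin 3} (hx : x j ≠ 0)
    (l : Fin 3) :
    HasDerivAt (fun t => confPow α (Function.update x j t l))
      (α * |x j| ^ (α - 1) * (Pi.single j 1 : Fin 3 → ℝ) l) (x j) := by
  by_cases h : l = j
  · subst h
    simpa using hasDerivAt_confPow α hx
  · simpa [Function.update_of_ne h, Pi.single_eq_of_ne h] using
      hasDerivAt_const (x j) (confPow α (x l))

theorem sq_rConf (α : ℝ) (q : Fin 3 → ℝ) :
    rConf α q ^ 2 = ∑ i : Fin 3, (α * confPow α (q i)) ^ 2 :=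
  Real.sq_sqrt (Finset.sum_nonneg fun _ _ => sq_nonneg _)

theorem confPow_ne_zero (α : ℝ) {x : ℝ} (hx : x ≠ 0) : confPow α x ≠ 0 :=
  mul_ne_zero (Real.rpow_pos_of_pos (abs_pos.mpr hx) _).ne' hx

theorem rConf_pos {α : ℝ} (hα : α ≠ 0) {q : Fin 3 → ℝ} {j : Fin 3} (hq : q j ≠ 0) :
    0 < rConf α q :=
  Real.sqrt_pos.mpr <| Finset.sum_pos' (fun _ _ => sq_nonneg _)
    ⟨j, Finset.mem_univ j, by have := confPow_ne_zero α hq; positivity⟩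

theorem hasDerivAt_sum_sq_confPow_update (α : ℝ) {x : Fin 3 → ℝ} {j : Fin 3} (hx : x j ≠ 0) :
    HasDerivAt (fun t => ∑ i : Fin 3, (α * confPow α (Function.update x j t i)) ^ 2)
      (α * |x j| ^ (α - 1) * (2 * α ^ 2 * confPow α (x j))) (x j) := by
  refine (HasDerivAt.fun_sum fun l _ =>
    ((hasDerivAt_confPow_update α hx l).const_mul α).fun_pow 2).congr_deriv ?_
  rw [Finset.sum_eq_single j (fun l _ hl => by simp [Pi.single_eq_of_ne hl]) (by simp)]
  simp only [Function.update_self, Pi.single_eq_same]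
  push_cast
  ring

theorem hasDerivAt_rConf_update {α : ℝ} (hα : α ≠ 0) {q : Fin 3 → ℝ} {j : Fin 3}
    (hq : q j ≠ 0) :
    HasDerivAt (fun t => rConf α (Function.update q j t))
      (α * |q j| ^ (α - 1) * (α ^ 2 * confPow α (q j) / rConf α q)) (q j) := by
  have hr := rConf_pos hα hq
  have h := (hasDerivAt_sum_sq_confPow_update α hq).sqrt
    (by simp only [Function.update_eq_self, ← sq_rConf]; positivity)
  refine h.congr_deriv ?_
  rw [Function.update_eq_self, ← rConf]
  field_simp

theorem pdp_Hconf (α m k : ℝ) (q : Fin 3 → ℝ) {p : Fin 3 → ℝ} {j : Fin 3} (hp : p j ≠ 0) :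
    pdp (Hconf α m k) j q p = α * |p j| ^ (α - 1) * (α ^ 2 * confPow α (p j) / m) := by
  simp only [pdp, Hconf, ← Finset.sum_div]
  rw [(((hasDerivAt_sum_sq_confPow_update α hp).div_const _).sub_const _).deriv]
  ring

theorem pdq_Hconf {α : ℝ} (hα : α ≠ 0) (m k : ℝ) {q : Fin 3 → ℝ} (p : Fin 3 → ℝ) {j : Fin 3}
    (hq : q j ≠ 0) :
    pdq (Hconf α m k) j q p =
      α * |q j| ^ (α - 1) * (k * α ^ 2 * confPow α (q j) / rConf α q ^ 3) := by
  have hr := (rConf_pos hα hq).ne'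
  have h := ((hasDerivAt_const (q j) k).fun_div (hasDerivAt_rConf_update hα hq)
    (by simpa using hr)).const_sub (∑ i : Fin 3, (α * confPow α (p i)) ^ 2 / (2 * m))
  simp only [pdq, Hconf]
  rw [h.deriv, Function.update_eq_self]
  field_simp
  ring

theorem pdp_Aconf (α m k : ℝ) (i : Fin 3) (q : Fin 3 → ℝ) {p : Fin 3 → ℝ} {j : Fin 3}
    (hp : p j ≠ 0) :
    pdp (Aconf α m k i) j q p = α * |p j| ^ (α - 1) * (
      α * ((Pi.single j 1 : Fin 3 → ℝ) (i + 1) * Lconf α (i + 2) q p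
        + confPow α (p (i + 1)) * (α ^ 2 *
          (confPow α (q (i + 2 + 1)) * (Pi.single j 1 : Fin 3 → ℝ) (i + 2 + 2)
            - confPow α (q (i + 2 + 2)) * (Pi.single j 1 : Fin 3 → ℝ) (i + 2 + 1)))
        - ((Pi.single j 1 : Fin 3 → ℝ) (i + 2) * Lconf α (i + 1) q p
        + confPow α (p (i + 2)) * (α ^ 2 *
          (confPow α (q (i + 1 + 1)) * (Pi.single j 1 : Fin 3 → ℝ) (i + 1 + 2)
            - confPow α (q (i + 1 + 2)) * (Pi.single j 1 : Fin 3 → ℝ) (i + 1 + 1)))))) := by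
  have hc := hasDerivAt_confPow_update α hp
  have hL (l : Fin 3) := (((hc (l + 2)).const_mul (confPow α (q (l + 1)))).fun_sub
    ((hc (l + 1)).const_mul (confPow α (q (l + 2))))).const_mul (α ^ 2)
  have h := ((((hc (i + 1)).fun_mul (hL (i + 2))).fun_sub
    ((hc (i + 2)).fun_mul (hL (i + 1)))).const_mul α).sub_const
      (α * m * k / rConf α q * confPow α (q i))
  simp only [pdp, Aconf, Lconf]
  rw [h.deriv]
  simp only [Function.update_eq_self]
  ring

theorem pdq_Aconf {α : ℝ} (hα : α ≠ 0) (m k : ℝ) (i : Fin 3) {q : Fin 3 → ℝ} (p : Fin 3 → ℝ)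
    {j : Fin 3} (hq : q j ≠ 0) :
    pdq (Aconf α m k i) j q p = α * |q j| ^ (α - 1) * (
      α * (confPow α (p (i + 1)) * (α ^ 2 *
          ((Pi.single j 1 : Fin 3 → ℝ) (i + 2 + 1) * confPow α (p (i + 2 + 2))
            - (Pi.single j 1 : Fin 3 → ℝ) (i + 2 + 2) * confPow α (p (i + 2 + 1))))
        - confPow α (p (i + 2)) * (α ^ 2 *
          ((Pi.single j 1 : Fin 3 → ℝ) (i + 1 + 1) * confPow α (p (i + 1 + 2))
            - (Pi.single j 1 : Fin 3 → ℝ) (i + 1 + 2) * confPow α (p (i + 1 + 1)))))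
      - α * m * k * ((Pi.single j 1 : Fin 3 → ℝ) i / rConf α q
        - α ^ 2 * confPow α (q j) * confPow α (q i) / rConf α q ^ 3)) := by
  have hr := (rConf_pos hα hq).ne'
  have hc := hasDerivAt_confPow_update α hq
  have hL (l : Fin 3) := (((hc (l + 1)).mul_const (confPow α (p (l + 2)))).fun_sub
    ((hc (l + 2)).mul_const (confPow α (p (l + 1))))).const_mul (α ^ 2)
  have h := ((((hL (i + 2)).const_mul (confPow α (p (i + 1)))).fun_sub
    ((hL (i + 1)).const_mul (confPow α (p (i + 2))))).const_mul α).fun_sub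
      (((hasDerivAt_const (q j) (α * m * k)).fun_div (hasDerivAt_rConf_update hα hq)
        (by simpa using hr)).fun_mul (hc i))
  simp only [pdq, Aconf, Lconf]
  rw [h.deriv]
  simp only [Function.update_eq_self]
  field_simp
  ring

/-- The weight of the conformable bracket cancels the derivatives of the conformable powers. -/
theorem confPB_weight_cancel {α x y : ℝ} (hα : α ≠ 0) (hx : x ≠ 0) (hy : y ≠ 0)
    (a b c d : ℝ) :
    (α ^ 2)⁻¹ * |x| ^ (1 - α) * |y| ^ (1 - α) *
      (α * |x| ^ (α - 1) * a * (α * |y| ^ (α - 1) * b)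
        - α * |y| ^ (α - 1) * c * (α * |x| ^ (α - 1) * d)) = a * b - c * d := by
  have hx' := (Real.rpow_pos_of_pos (abs_pos.mpr hx) (α - 1)).ne'
  have hy' := (Real.rpow_pos_of_pos (abs_pos.mpr hy) (α - 1)).ne'
  rw [← neg_sub α 1, Real.rpow_neg (abs_nonneg x), Real.rpow_neg (abs_nonneg y)]
  field_simp

/-- each conformable Laplace–Runge–Lenz component is a constant of
motion of the conformable Kepler Hamiltonian: `{H_α, Aᵅᵢ}_α = 0` at every point
with all `qʲ ≠ 0` and `pⱼ ≠ 0`. -/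
theorem confPB_Hconf_Aconf_eq_zero
    (α m k : ℝ) (hα : 1 ≤ α) (hm : 0 < m)
    (q p : Fin 3 → ℝ) (hq : ∀ j, q j ≠ 0) (hp : ∀ j, p j ≠ 0)
    (i : Fin 3) :
    confPB α (Hconf α m k) (Aconf α m k i) q p = 0 := by
  have hα₀ : α ≠ 0 := by positivity
  have hr := (rConf_pos hα₀ (hq 0)).ne'
  have hsq := sq_rConf α q
  simp only [confPB, pdp_Hconf α m k q (hp _), pdq_Hconf hα₀ m k p (hq _),
    pdp_Aconf α m k i q (hp _), pdq_Aconf hα₀ m k i p (hq _),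
    confPB_weight_cancel hα₀ (hp _) (hq _), Lconf]
  rw [Fin.sum_univ_three] at hsq ⊢
  generalize rConf α q = r at *
  fin_cases i <;> simp <;> field_simp
  · linear_combination (-α ^ 3 * m * k * confPow α (p 0)) * hsq
  · linear_combination (-α ^ 3 * m * k * confPow α (p 1)) * hsq
  · linear_combination (-α ^ 3 * m * k * confPow α (p 2)) * hsq
end
end

section
/- The radial functions M₁ = p_r p_φ/(m sin²φ) and M₂ = k − p_φ²/(m r sin⁴φ) satisfy, at every point (r, φ, p_r, p_φ) with r > 0 and sin φ ≠ 0, the rotation-type relations {K, M₁} = −γ·M₂ and {K, M₂} = γ·M₁, where γ = p_φ/(m r² sin²φ). -/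
noncomputable section

/-- Partial derivative with respect to the first coordinate `r`. -/
def pdR (f : ℝ → ℝ → ℝ → ℝ → ℝ) (r φ pr pφ : ℝ) : ℝ :=
  deriv (fun x => f x φ pr pφ) r

/-- Partial derivative with respect to the second coordinate `φ`. -/
def pdPhi (f : ℝ → ℝ → ℝ → ℝ → ℝ) (r φ pr pφ : ℝ) : ℝ :=
  deriv (fun x => f r x pr pφ) φ

/-- Partial derivative with respect to the third coordinate `p_r`. -/
def pdPr (f : ℝ → ℝ → ℝ → ℝ → ℝ) (r φ pr pφ : ℝ) : ℝ :=
  deriv (fun x => f r φ x pφ) pr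

/-- Partial derivative with respect to the fourth coordinate `p_φ`. -/
def pdPphi (f : ℝ → ℝ → ℝ → ℝ → ℝ) (r φ pr pφ : ℝ) : ℝ :=
  deriv (fun x => f r φ pr x) pφ

/-- The Poisson bracket in conformable polar coordinates:
`{f,g} = (∂f/∂p_r ∂g/∂r - ∂f/∂r ∂g/∂p_r) + sin²φ (∂f/∂p_φ ∂g/∂φ - ∂f/∂φ ∂g/∂p_φ)`. -/
def polarPB (f g : ℝ → ℝ → ℝ → ℝ → ℝ) (r φ pr pφ : ℝ) : ℝ :=
  (pdPr f r φ pr pφ * pdR g r φ pr pφ - pdR f r φ pr pφ * pdPr g r φ pr pφ) +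
  Real.sin φ ^ 2 *
    (pdPphi f r φ pr pφ * pdPhi g r φ pr pφ - pdPhi f r φ pr pφ * pdPphi g r φ pr pφ)

/-- The Kepler Hamiltonian in conformable polar coordinates:
`K = p_r²/(2m) + p_φ²/(2m r² sin⁴φ) - k/r`. -/
def polarK (m k : ℝ) (r φ pr pφ : ℝ) : ℝ :=
  pr ^ 2 / (2 * m) + pφ ^ 2 / (2 * m * r ^ 2 * Real.sin φ ^ 4) - k / r

theorem pdR_polarK (m k : ℝ) {r φ : ℝ} (pr pφ : ℝ) (hm : m ≠ 0) (hr : r ≠ 0)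
    (hs : Real.sin φ ≠ 0) :
    pdR (polarK m k) r φ pr pφ
      = -(pφ ^ 2 / (m * r ^ 3 * Real.sin φ ^ 4)) + k / r ^ 2 := by
  have h₁ := (hasDerivAt_const r (pφ ^ 2)).fun_div
    ((((hasDerivAt_id' r).fun_pow 2).const_mul (2 * m)).mul_const (Real.sin φ ^ 4))
    (by positivity)
  have h₂ := (hasDerivAt_const r k).fun_div (hasDerivAt_id' r) hr
  refine ((h₁.const_add (pr ^ 2 / (2 * m))).fun_sub h₂).deriv.trans ?_
  field_simp
  ring

theorem pdPhi_polarK (m k : ℝ) {r φ : ℝ} (pr pφ : ℝ) (hm : m ≠ 0) (hr : r ≠ 0)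
    (hs : Real.sin φ ≠ 0) :
    pdPhi (polarK m k) r φ pr pφ
      = -(2 * pφ ^ 2 * Real.cos φ / (m * r ^ 2 * Real.sin φ ^ 5)) := by
  have h := (hasDerivAt_const φ (pφ ^ 2)).fun_div
    (((Real.hasDerivAt_sin φ).fun_pow 4).const_mul (2 * m * r ^ 2)) (by positivity)
  refine ((h.const_add (pr ^ 2 / (2 * m))).sub_const (k / r)).deriv.trans ?_
  field_simp
  ring

theorem pdPr_polarK (m k r φ pr pφ : ℝ) : pdPr (polarK m k) r φ pr pφ = pr / m := by
  have h := ((hasDerivAt_id' pr).fun_pow 2).div_const (2 * m)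
  refine ((h.add_const (pφ ^ 2 / (2 * m * r ^ 2 * Real.sin φ ^ 4))).sub_const
    (k / r)).deriv.trans ?_
  field

theorem pdPphi_polarK (m k r φ pr pφ : ℝ) :
    pdPphi (polarK m k) r φ pr pφ = pφ / (m * r ^ 2 * Real.sin φ ^ 4) := by
  have h := ((hasDerivAt_id' pφ).fun_pow 2).div_const (2 * m * r ^ 2 * Real.sin φ ^ 4)
  refine ((h.const_add (pr ^ 2 / (2 * m))).sub_const (k / r)).deriv.trans ?_
  field

/-- the radial functions `M₁ = p_r p_φ/(m sin²φ)` and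
`M₂ = k - p_φ²/(m r sin⁴φ)` satisfy the rotation-type relations
`{K, M₁} = -γ M₂` and `{K, M₂} = γ M₁` with `γ = p_φ/(m r² sin²φ)`. -/
theorem polarPB_K_M_rotation
    (m k : ℝ) (hm : 0 < m) (r φ pr pφ : ℝ) (hr : 0 < r) (hs : Real.sin φ ≠ 0) :
    polarPB (polarK m k) (fun _ φ pr pφ => pr * pφ / (m * Real.sin φ ^ 2)) r φ pr pφ
      = -(pφ / (m * r ^ 2 * Real.sin φ ^ 2)) *
          (k - pφ ^ 2 / (m * r * Real.sin φ ^ 4)) ∧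
    polarPB (polarK m k) (fun r φ _ pφ => k - pφ ^ 2 / (m * r * Real.sin φ ^ 4)) r φ pr pφ
      = pφ / (m * r ^ 2 * Real.sin φ ^ 2) *
          (pr * pφ / (m * Real.sin φ ^ 2)) := by
  have hm' := hm.ne'
  have hr' := hr.ne'
  constructor
  · have hφ := (hasDerivAt_const φ (pr * pφ)).fun_div
      (((Real.hasDerivAt_sin φ).fun_pow 2).const_mul m) (by positivity)
    have hpr := ((hasDerivAt_id' pr).mul_const pφ).div_const (m * Real.sin φ ^ 2)
    have hpφ := ((hasDerivAt_id' pφ).const_mul pr).div_const (m * Real.sin φ ^ 2)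
    rw [polarPB, pdR_polarK m k pr pφ hm' hr' hs, pdPhi_polarK m k pr pφ hm' hr' hs,
      pdPr_polarK, pdPphi_polarK, pdR, pdPhi, pdPr, pdPphi, deriv_const, hφ.deriv, hpr.deriv,
      hpφ.deriv]
    field_simp
    ring
  · have hR := ((hasDerivAt_const r (pφ ^ 2)).fun_div
      (((hasDerivAt_id' r).const_mul m).mul_const (Real.sin φ ^ 4)) (by positivity)).const_sub k
    have hφ := ((hasDerivAt_const φ (pφ ^ 2)).fun_div
      (((Real.hasDerivAt_sin φ).fun_pow 4).const_mul (m * r)) (by positivity)).const_sub k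
    have hpφ := (((hasDerivAt_id' pφ).fun_pow 2).div_const
      (m * r * Real.sin φ ^ 4)).const_sub k
    rw [polarPB, pdR_polarK m k pr pφ hm' hr' hs, pdPhi_polarK m k pr pφ hm' hr' hs,
      pdPr_polarK, pdPphi_polarK, pdR, pdPhi, pdPr, pdPphi, deriv_const, hR.deriv, hφ.deriv,
      hpφ.deriv]
    field_simp
    ring
end
end
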